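/- Let n ≥ 2, d ≥ 3, and let 𝔣 = (f_1,…,f_n) be an n-tuple of homogeneous forms of degree d−1 in ℂ[z_1,…,z_n] whose only common zero in ℂ^n is the origin. Then the associated form 𝐟 of 𝔣 is a Macaulay inverse system of the algebra M_𝔣 = ℂ[z_1,…,z_n]/(f_1,…,f_n): the apolar ideal 𝐟^⊥ := {g ∈ ℂ[z_1,…,z_n] : g ⋄ 𝐟 = 0} equals the ideal (f_1,…,f_n). -/

import Mathlib

open MvPolynomial

noncomputable section

/-- The partial derivative `∂/∂e_i` as a `ℂ`-linear endomorphism of `ℂ[e_1,…,e_n]`. -/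
def pdEnd (n : ℕ) (i : Fin n) : Module.End ℂ (MvPolynomial (Fin n) ℂ) :=
  (pderiv i).toLinearMap

/-- The polar pairing (apolarity action) `g ⋄ F := g(∂/∂e_1,…,∂/∂e_n) F`. -/
def diamond {n : ℕ} (g F : MvPolynomial (Fin n) ℂ) : MvPolynomial (Fin n) ℂ :=
  ∑ m ∈ g.support, g.coeff m • ((List.ofFn fun i => pdEnd n i ^ m i).prod F)

end
noncomputable section

/-- The Jacobian `det (∂f_i/∂z_j)` of an `n`-tuple of forms. -/
def jacPoly (n : ℕ) (f : Fin n → MvPolynomial (Fin n) ℂ) : MvPolynomial (Fin n) ℂ :=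
  Matrix.det (Matrix.of fun i j : Fin n => pderiv j (f i))

/-- `μ` is the system of coefficients defining the associated form of the tuple `𝔣`. -/
def IsAssocCoeffsT (n d : ℕ) (f : Fin n → MvPolynomial (Fin n) ℂ)
    (μ : (Fin n → ℕ) → ℂ) : Prop :=
  ∀ m : Fin n → ℕ, (∑ i, m i) = n * (d - 2) →
    (∏ i, X i ^ m i) - C (μ m) * jacPoly n f ∈ Ideal.span (Set.range f)

/-- The associated form built from the coefficients `μ`. -/
def assocForm (n d : ℕ) (μ : (Fin n → ℕ) → ℂ) : MvPolynomial (Fin n) ℂ :=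
  ∑ m ∈ Finset.Nat.antidiagonalTuple n (n * (d - 2)),
    C ((Nat.multinomial Finset.univ m : ℂ) * μ m) * ∏ i, X i ^ m i

end

section CommAlg

variable {K A : Type*} [Field K] [CommRing A] [Algebra K A]

/-- `x` is a nonzerodivisor modulo the ideal `J`. -/
def NonZeroDivisorMod (J : Ideal A) (x : A) : Prop :=
  ∀ u, x * u ∈ J → u ∈ J

/-- The list `l` is a (weakly) regular sequence modulo the ideal `J`. -/
def RegularSeqMod : Ideal A → List A → Prop
  | _, [] => True
  | J, x :: l => NonZeroDivisorMod J x ∧ RegularSeqMod (J ⊔ Ideal.span {x}) l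

/-- The socle `(J : m) / J` of `A / J` with respect to `m` has dimension at most one over `K`. -/
def SocleDimLeOne (K : Type*) [Field K] [Algebra K A] (m J : Ideal A) : Prop :=
  ∀ u v, (∀ a ∈ m, a * u ∈ J) → (∀ a ∈ m, a * v ∈ J) → v ∉ J → ∃ c : K, u - c • v ∈ J

theorem mem_sup_span_singleton_iff {J : Ideal A} {x u : A} :
    u ∈ J ⊔ Ideal.span {x} ↔ ∃ t, u - x * t ∈ J := by
  rw [sup_comm, Ideal.mem_span_singleton_sup]
  constructor
  · rintro ⟨a, b, hb, rfl⟩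
    exact ⟨a, by simpa [mul_comm] using hb⟩
  · rintro ⟨t, ht⟩
    exact ⟨t, _, ht, by ring⟩

/-- If `x, y` is a regular sequence modulo `J`, then `x` is regular modulo `J + (y)`. -/
theorem NonZeroDivisorMod.swap {J : Ideal A} {x y : A} (hx : NonZeroDivisorMod J x)
    (hxy : NonZeroDivisorMod (J ⊔ Ideal.span {x}) y) :
    NonZeroDivisorMod (J ⊔ Ideal.span {y}) x := by
  intro u hu
  obtain ⟨t, ht⟩ := mem_sup_span_singleton_iff.1 hu
  obtain ⟨s, hs⟩ := mem_sup_span_singleton_iff.1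
    (hxy t (mem_sup_span_singleton_iff.2 ⟨u, by simpa using J.neg_mem ht⟩))
  refine mem_sup_span_singleton_iff.2 ⟨s, hx _ ?_⟩
  have := J.add_mem ht (J.mul_mem_left y hs)
  convert this using 1
  ring

/-- Exchanging the last element of a regular sequence preserves the socle dimension bound. -/
theorem SocleDimLeOne.exchange {m J : Ideal A} {x y : A} (hxm : x ∈ m)
    (hx : NonZeroDivisorMod J x) (hy : NonZeroDivisorMod J y)
    (h : SocleDimLeOne K m (J ⊔ Ideal.span {x})) :
    SocleDimLeOne K m (J ⊔ Ideal.span {y}) := by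
  have transfer : ∀ u w, x * u - y * w ∈ J → (∀ a ∈ m, a * u ∈ J ⊔ Ideal.span {y}) →
      ∀ a ∈ m, a * w ∈ J ⊔ Ideal.span {x} := by
    intro u w huw hu a ha
    obtain ⟨t, ht⟩ := mem_sup_span_singleton_iff.1 (hu a ha)
    refine mem_sup_span_singleton_iff.2 ⟨t, hy _ ?_⟩
    have := J.sub_mem (J.mul_mem_left x ht) (J.mul_mem_left a huw)
    convert this using 1
    ring
  intro u v hu hv hvJ
  obtain ⟨u₁, hu₁⟩ := mem_sup_span_singleton_iff.1 (hu x hxm)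
  obtain ⟨v₁, hv₁⟩ := mem_sup_span_singleton_iff.1 (hv x hxm)
  have hv₁J : v₁ ∉ J ⊔ Ideal.span {x} := by
    intro hmem
    obtain ⟨t, ht⟩ := mem_sup_span_singleton_iff.1 hmem
    refine hvJ (mem_sup_span_singleton_iff.2 ⟨t, hx _ ?_⟩)
    have := J.add_mem hv₁ (J.mul_mem_left y ht)
    convert this using 1
    ring
  obtain ⟨c, hc⟩ := h u₁ v₁ (transfer u u₁ hu₁ hu) (transfer v v₁ hv₁ hv) hv₁J
  obtain ⟨t, ht⟩ := mem_sup_span_singleton_iff.1 hc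
  refine ⟨c, mem_sup_span_singleton_iff.2 ⟨t, hx _ ?_⟩⟩
  rw [Algebra.smul_def] at ht ⊢
  have := J.add_mem (J.sub_mem hu₁ (J.mul_mem_left (algebraMap K A c) hv₁)) (J.mul_mem_left y ht)
  convert this using 1
  ring

theorem regularSeqMod_append {J : Ideal A} {l₁ l₂ : List A} :
    RegularSeqMod J (l₁ ++ l₂) ↔
      RegularSeqMod J l₁ ∧ RegularSeqMod (J ⊔ Ideal.ofList l₁) l₂ := by
  induction l₁ generalizing J with
  | nil => simp [RegularSeqMod]
  | cons a l ih => simp [RegularSeqMod, ih, and_assoc, Ideal.ofList_cons, sup_assoc]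

/-- An element regular modulo every initial part of a regular sequence can be put in front. -/
theorem RegularSeqMod.sup_span_singleton {J : Ideal A} {l : List A} {v : A}
    (hl : RegularSeqMod J l)
    (hv : ∀ l', l' <+: l → NonZeroDivisorMod (J ⊔ Ideal.ofList l') v) :
    RegularSeqMod (J ⊔ Ideal.span {v}) l := by
  induction l generalizing J with
  | nil => trivial
  | cons a l ih =>
    refine ⟨hl.1.swap ?_, ?_⟩
    · simpa using hv [a] (by simp)
    · rw [sup_right_comm]
      refine ih hl.2 fun l' hl' => ?_
      have := hv (a :: l') (by simpa using hl')
      rwa [Ideal.ofList_cons, ← sup_assoc] at this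

theorem nonZeroDivisorMod_iff_forall_associatedPrimes [IsNoetherianRing A] {J : Ideal A} {x : A} :
    NonZeroDivisorMod J x ↔ ∀ P ∈ associatedPrimes A (A ⧸ J), x ∉ P := by
  have h : (∀ P ∈ associatedPrimes A (A ⧸ J), x ∉ P) ↔
      x ∉ ⋃ P ∈ associatedPrimes A (A ⧸ J), (P : Set A) := by simp
  rw [h, biUnion_associatedPrimes_eq_compl_regular, Set.notMem_compl_iff, Set.mem_ofPred_eq,
    isSMulRegular_iff_right_eq_zero_of_smul, Ideal.Quotient.mk_surjective.forall]
  simp only [Algebra.smul_def, Ideal.Quotient.algebraMap_eq, ← map_mul,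
    Ideal.Quotient.eq_zero_iff_mem, NonZeroDivisorMod]

/-- If every prime containing the subspace `V` contains `m`, then `V` contains a common
nonzerodivisor modulo finitely many ideals, provided that `m` contains one for each of them. -/
theorem exists_mem_forall_nonZeroDivisorMod [IsNoetherianRing A] [Infinite K] {m : Ideal A}
    {V : Submodule K A} (hV : ∀ P : Ideal A, P.IsPrime → (V : Set A) ⊆ P → m ≤ P)
    {S : Set (Ideal A)} (hS : S.Finite) (h : ∀ J ∈ S, ∃ x ∈ m, NonZeroDivisorMod J x) :
    ∃ v ∈ V, ∀ J ∈ S, NonZeroDivisorMod J v := by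
  have hfin : (⋃ J ∈ S, associatedPrimes A (A ⧸ J)).Finite :=
    hS.biUnion fun J _ => associatedPrimes.finite A (A ⧸ J)
  have : Finite (⋃ J ∈ S, associatedPrimes A (A ⧸ J)) := hfin
  by_contra! hcon
  obtain ⟨⟨P, hP⟩, hPtop⟩ := Subspace.exists_eq_top_of_iUnion_eq_univ (k := K) (E := V)
    (p := fun P : (⋃ J ∈ S, associatedPrimes A (A ⧸ J)) =>
      ((P : Ideal A).restrictScalars K).comap V.subtype) (by
    refine Set.eq_univ_of_forall fun ⟨v, hv⟩ => ?_
    obtain ⟨J, hJ, hvJ⟩ := hcon v hv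
    rw [nonZeroDivisorMod_iff_forall_associatedPrimes] at hvJ
    push Not at hvJ
    obtain ⟨P, hP, hvP⟩ := hvJ
    exact Set.mem_iUnion.2 ⟨⟨P, Set.mem_biUnion hJ hP⟩, hvP⟩)
  obtain ⟨J, hJ, hPJ⟩ := Set.mem_iUnion₂.1 hP
  obtain ⟨x, hxm, hx⟩ := h J hJ
  refine nonZeroDivisorMod_iff_forall_associatedPrimes.1 hx P hPJ (hV P hPJ.isPrime ?_ hxm)
  intro v hv
  have : (⟨v, hv⟩ : V) ∈ (⊤ : Submodule K V) := trivial
  rw [← hPtop] at this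
  exact this

theorem exists_regularSeqMod_of_subspace [IsNoetherianRing A] [Infinite K] {m : Ideal A}
    {V : Submodule K A}
    (hV : ∀ P : Ideal A, P.IsPrime → (V : Set A) ⊆ P → m ≤ P)
    (l : List A) (J : Ideal A) (hlm : ∀ x ∈ l, x ∈ m) (hl : RegularSeqMod J l)
    (hsoc : SocleDimLeOne K m (J ⊔ Ideal.ofList l)) :
    ∃ l' : List A, l'.length = l.length ∧ (∀ x ∈ l', x ∈ V) ∧ RegularSeqMod J l' ∧
      SocleDimLeOne K m (J ⊔ Ideal.ofList l') := by
  induction l using List.reverseRecOn generalizing J with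
  | nil => exact ⟨[], rfl, by simp, hl, hsoc⟩
  | append_singleton l x ih =>
    obtain ⟨hl₁, hx, -⟩ := regularSeqMod_append.1 hl
    have hS : {I | ∃ l', l' <+: l ∧ I = J ⊔ Ideal.ofList l'}.Finite := by
      refine (l.inits.finite_toSet.image fun l' => J ⊔ Ideal.ofList l').subset ?_
      rintro _ ⟨l', hl', rfl⟩
      exact ⟨l', by simpa using hl', rfl⟩
    obtain ⟨v, hvV, hv⟩ := exists_mem_forall_nonZeroDivisorMod hV hS (by
      rintro _ ⟨l', ⟨t, rfl⟩, rfl⟩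
      rw [List.append_assoc, regularSeqMod_append] at hl
      cases t with
      | nil => exact ⟨x, hlm x (by simp), hl.2.1⟩
      | cons y t => exact ⟨y, hlm y (by simp), hl.2.1⟩)
    have hv' : ∀ l', l' <+: l → NonZeroDivisorMod (J ⊔ Ideal.ofList l') v :=
      fun l' hl' => hv _ ⟨l', hl', rfl⟩
    obtain ⟨l', hlen, hl'V, hl', hsoc'⟩ := ih (J ⊔ Ideal.span {v})
      (fun y hy => hlm y (by simp [hy])) (hl₁.sup_span_singleton hv') (by
        rw [sup_right_comm]
        refine SocleDimLeOne.exchange (hlm x (by simp)) hx (hv' l List.prefix_rfl) ?_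
        simpa [Ideal.ofList_append, sup_assoc] using hsoc)
    refine ⟨v :: l', by simp [hlen], ?_, ⟨by simpa using hv' [] List.nil_prefix, hl'⟩, ?_⟩
    · simpa using ⟨hvV, hl'V⟩
    · simpa [Ideal.ofList_cons, sup_assoc] using hsoc'

/-- The span of a regular sequence has dimension at least its length. -/
theorem RegularSeqMod.finrank_add_length_le {J m : Ideal A} (hm : m ≠ ⊤) {l : List A}
    (hJm : J ≤ m) (hlm : ∀ x ∈ l, x ∈ m) (hl : RegularSeqMod J l) {W : Submodule K A}
    [FiniteDimensional K W] (hW : (W : Set A) ⊆ J) :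
    Module.finrank K W + l.length ≤
      Module.finrank K (W ⊔ Submodule.span K {x | x ∈ l} : Submodule K A) := by
  induction l generalizing J W with
  | nil =>
    have hempty : {x : A | x ∈ ([] : List A)} = ∅ := by ext; simp
    rw [hempty, Submodule.span_empty, sup_bot_eq, List.length_nil, add_zero]
  | cons a l ih =>
    have haJ : a ∉ J := fun ha =>
      hm (top_le_iff.1 ((Ideal.eq_top_iff_one J).2 (hl.1 1 (by simpa using ha)) ▸ hJm))
    have haW : a ∉ W := fun h => haJ (hW h)
    have hlt : W < W ⊔ Submodule.span K {a} := by
      refine lt_of_le_of_ne le_sup_left fun h => haW ?_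
      rw [h]
      exact Submodule.mem_sup_right (Submodule.mem_span_singleton_self a)
    have h1 := Submodule.finrank_lt_finrank_of_lt hlt
    have h2 := ih (J := J ⊔ Ideal.span {a}) (W := W ⊔ Submodule.span K {a})
      (sup_le hJm ((Ideal.span_singleton_le_iff_mem m).2 (hlm a (by simp))))
      (fun x hx => hlm x (by simp [hx])) hl.2 (by
        intro y hy
        obtain ⟨w, hw, z, hz, rfl⟩ := Submodule.mem_sup.1 hy
        obtain ⟨c, rfl⟩ := Submodule.mem_span_singleton.1 hz
        refine add_mem (Ideal.mem_sup_left (hW hw)) (Ideal.mem_sup_right ?_)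
        rw [Algebra.smul_def]
        exact Ideal.mul_mem_left _ _ (Ideal.mem_span_singleton_self a))
    have h3 : W ⊔ Submodule.span K {x | x ∈ a :: l} =
        W ⊔ Submodule.span K {a} ⊔ Submodule.span K {x | x ∈ l} := by
      rw [sup_assoc, ← Submodule.span_union]
      congr 2
      ext; simp
    rw [h3, List.length_cons]
    omega

end CommAlg
section Polynomial

variable {σ K : Type*} [Field K]

theorem mem_span_X_pow_image_iff {T : Set σ} {s : ℕ} {p : MvPolynomial σ K} :
    p ∈ Ideal.span ((fun j => (X j : MvPolynomial σ K) ^ s) '' T) ↔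
      ∀ m ∈ p.support, ∃ j ∈ T, s ≤ m j := by
  have h := @mem_ideal_span_monomial_image σ K _ p ((fun j => Finsupp.single j s) '' T)
  simpa [Set.image_image, ← X_pow_eq_monomial] using h

theorem nonZeroDivisorMod_span_X_pow_image {T : Set σ} {s : ℕ} {i : σ} (hi : i ∉ T) :
    NonZeroDivisorMod (Ideal.span ((fun j => (X j : MvPolynomial σ K) ^ s) '' T)) (X i) := by
  classical
  intro u hu
  rw [mem_span_X_pow_image_iff] at hu ⊢
  intro m hm
  obtain ⟨j, hj, hjm⟩ := hu (Finsupp.single i 1 + m) (by simpa using hm)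
  have hij : i ≠ j := fun h => hi (h ▸ hj)
  exact ⟨j, hj, by simpa [hij.symm] using hjm⟩

theorem regularSeqMod_map_X {T : Set σ} {l : List σ} (hl : l.Nodup) (hT : ∀ i ∈ l, i ∉ T) :
    RegularSeqMod (Ideal.span ((fun j => (X j : MvPolynomial σ K) ^ 1) '' T)) (l.map X) := by
  induction l generalizing T with
  | nil => trivial
  | cons a l ih =>
    rw [List.nodup_cons] at hl
    refine ⟨nonZeroDivisorMod_span_X_pow_image (hT a (by simp)), ?_⟩
    have h := ih hl.2 (T := insert a T) fun i hi => by
      have : i ≠ a := fun h => hl.1 (h ▸ hi)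
      simpa [this] using hT i (by simp [hi])
    rwa [Set.image_insert_eq, Ideal.span_insert, pow_one, sup_comm] at h

theorem socleDimLeOne_idealOfVars :
    SocleDimLeOne K (idealOfVars σ K) (idealOfVars σ K) := by
  have hmem : ∀ p : MvPolynomial σ K, p ∈ idealOfVars σ K ↔ p.coeff 0 = 0 := fun p => by
    simpa [Finsupp.degree_eq_zero_iff] using mem_pow_idealOfVars_iff' 1 p
  intro u v _ _ hv
  rw [hmem] at hv
  refine ⟨u.coeff 0 / v.coeff 0, ?_⟩
  rw [hmem]
  simp [hv]

/-- An ideal generated by `n` polynomials without constant terms in `n` variables, having the ideal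
of the variables as its radical, has a socle of dimension at most one. -/
theorem socleDimLeOne_span_range [Infinite K] {n : ℕ} {f : Fin n → MvPolynomial (Fin n) K}
    (hf : ∀ i, f i ∈ idealOfVars (Fin n) K)
    (hrad : ∀ i, (X i : MvPolynomial (Fin n) K) ∈ (Ideal.span (Set.range f)).radical) :
    SocleDimLeOne K (idealOfVars (Fin n) K) (Ideal.span (Set.range f)) := by
  set m := idealOfVars (Fin n) K with hm
  set V := Submodule.span K (Set.range f) with hVdef
  have hVm : V ≤ m.restrictScalars K := Submodule.span_le.2 (by rintro _ ⟨i, rfl⟩; exact hf i)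
  have hV : ∀ P : Ideal (MvPolynomial (Fin n) K), P.IsPrime →
      (V : Set (MvPolynomial (Fin n) K)) ⊆ P → m ≤ P := by
    intro P hP hVP
    refine Ideal.span_le.2 ?_
    rintro _ ⟨i, rfl⟩
    refine hP.radical_le_iff.2 (Ideal.span_le.2 ?_) (hrad i)
    exact fun p hp => hVP (Submodule.subset_span hp)
  have hX : Ideal.ofList ((List.finRange n).map X) = m := by
    rw [hm, idealOfVars, Ideal.ofList]
    congr 1
    ext p
    simp
  have hreg : RegularSeqMod (⊥ : Ideal (MvPolynomial (Fin n) K)) ((List.finRange n).map X) := by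
    simpa using regularSeqMod_map_X (K := K) (T := ∅) (List.nodup_finRange n) (by simp)
  obtain ⟨l, hlen, hlV, hl, hsoc⟩ := exists_regularSeqMod_of_subspace hV
    ((List.finRange n).map X) ⊥ (fun x hx => hX ▸ Ideal.subset_span hx) hreg
    (by rw [bot_sup_eq, hX]; exact socleDimLeOne_idealOfVars)
  have hmtop : m ≠ ⊤ := by
    rw [Ideal.ne_top_iff_one, ← pow_one m, ← C_1, hm, C_mem_pow_idealOfVars_iff]
    simp
  have : FiniteDimensional K V := FiniteDimensional.span_of_finite K (Set.finite_range f)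
  have hle : Submodule.span K {x | x ∈ l} ≤ V := Submodule.span_le.2 hlV
  have hrank := hl.finrank_add_length_le (K := K) hmtop bot_le (fun x hx => hVm (hlV x hx))
    (W := ⊥) (by simp)
  have hVle : Module.finrank K V ≤ n := by
    simpa [Set.finrank, hVdef] using finrank_range_le_card (R := K) f
  have heq : Submodule.span K {x | x ∈ l} = V := by
    refine Submodule.eq_of_le_of_finrank_le hle (hVle.trans ?_)
    rw [bot_sup_eq] at hrank
    simpa [hlen] using hrank
  have hideal : Ideal.ofList l = Ideal.span (Set.range f) := by
    refine le_antisymm (Ideal.span_le.2 fun x hx => ?_) (Ideal.span_le.2 ?_)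
    · exact Submodule.span_le_restrictScalars K _ _ (hlV x hx)
    · rintro _ ⟨i, rfl⟩
      have : f i ∈ V := Submodule.subset_span ⟨i, rfl⟩
      rw [← heq] at this
      exact Submodule.span_le_restrictScalars K _ _ this
  simpa [hideal] using hsoc

end Polynomial

section Determinant

variable {ι A : Type*} [Fintype ι] [DecidableEq ι] [CommRing A]

/-- Cramer's rule modulo an ideal. -/
theorem det_mul_mem_of_mulVec_mem {J : Ideal A} {M : Matrix ι ι A} {v : ι → A}
    (h : ∀ i, M.mulVec v i ∈ J) (k : ι) : M.det * v k ∈ J := by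
  have h1 : M.adjugate.mulVec (M.mulVec v) = M.det • v := by
    rw [Matrix.mulVec_mulVec, Matrix.adjugate_mul, Matrix.smul_mulVec, Matrix.one_mulVec]
  have h2 := congrFun h1 k
  rw [Pi.smul_apply, smul_eq_mul] at h2
  rw [← h2]
  exact Ideal.sum_mem _ fun j _ => J.mul_mem_left _ (h j)

/-- Any matrix taking the variables to their powers has determinant congruent to the obvious one
modulo these powers. -/
theorem det_sub_prod_X_pow_mem {K : Type*} [Field K] {s : ℕ}
    (B : Matrix ι ι (MvPolynomial ι K)) (hB : ∀ i, B.mulVec X i = X i ^ (s + 1)) :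
    B.det - ∏ i, X i ^ s ∈
      Ideal.span (Set.range fun j => (X j : MvPolynomial ι K) ^ (s + 1)) := by
  set J := Ideal.span (Set.range fun j => (X j : MvPolynomial ι K) ^ (s + 1)) with hJ
  set D : Matrix ι ι (MvPolynomial ι K) := Matrix.diagonal fun i => X i ^ s with hD
  have hDX : ∀ i, D.mulVec X i = X i ^ (s + 1) := fun i => by
    rw [hD, Matrix.mulVec_diagonal, pow_succ]
  let N : Finset ι → Matrix ι ι (MvPolynomial ι K) := fun T =>
    Matrix.of fun i => if i ∈ T then D i else B i
  have hNX : ∀ T i, (N T).mulVec X i = X i ^ (s + 1) := by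
    intro T i
    by_cases hi : i ∈ T
    · rw [← hDX i]; simp [N, Matrix.mulVec, hi]
    · rw [← hB i]; simp [N, Matrix.mulVec, hi]
  have hstep : ∀ T : Finset ι, B.det - (N T).det ∈ J := by
    intro T
    induction T using Finset.induction_on with
    | empty =>
      rw [show N ∅ = B by ext : 2; simp [N], sub_self]
      exact zero_mem _
    | insert i T hi ih =>
      have h1 : N (insert i T) = (N T).updateRow i (D i) := by
        ext j k : 2
        by_cases hj : j = i
        · subst hj; simp [N]
        · simp [N, hj, Matrix.updateRow_apply]
      have h2 : N T = (N T).updateRow i ((B i - D i) + D i) := by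
        ext j k : 2
        by_cases hj : j = i
        · subst hj; simp [N, hi]
        · simp [hj]
      have h3 : (N T).det = ((N T).updateRow i (B i - D i)).det + (N (insert i T)).det := by
        rw [h1, ← Matrix.det_updateRow_add, ← h2]
      have h4 : ((N T).updateRow i (B i - D i)).det ∈
          Ideal.span ((fun j => (X j : MvPolynomial ι K) ^ (s + 1)) '' {i}ᶜ) := by
        refine nonZeroDivisorMod_span_X_pow_image (i := i) (by simp) _ ?_
        rw [mul_comm]
        refine det_mul_mem_of_mulVec_mem (fun j => ?_) i
        by_cases hj : j = i
        · subst hj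
          have : ((N T).updateRow j (B j - D j)).mulVec X j = B.mulVec X j - D.mulVec X j := by
            simp only [Matrix.mulVec, Matrix.updateRow_self]
            exact sub_dotProduct _ _ _
          rw [this, hB, hDX, sub_self]
          exact zero_mem _
        · have : ((N T).updateRow i (B i - D i)).mulVec X j = (N T).mulVec X j := by
            simp [Matrix.mulVec, hj]
          rw [this, hNX]
          exact Ideal.subset_span ⟨j, hj, rfl⟩
      have h5 := J.add_mem ih (Ideal.span_mono (Set.image_subset_range _ _) h4)
      rw [h3] at h5
      convert h5 using 1
      ring
  have := hstep Finset.univ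
  rwa [show N Finset.univ = D by ext : 2; simp [N], hD, Matrix.det_diagonal] at this

end Determinant

section Jacobian

variable {n e : ℕ} {f : Fin n → MvPolynomial (Fin n) ℂ}

theorem X_mem_radical_span_range
    (hzero : ∀ p : Fin n → ℂ, (∀ i, eval p (f i) = 0) → p = 0) (i : Fin n) :
    X i ∈ (Ideal.span (Set.range f)).radical := by
  rw [← vanishingIdeal_zeroLocus_eq_radical (K := ℂ), mem_vanishingIdeal_iff]
  intro x hx
  have : x = 0 := hzero x fun j => by
    simpa [aeval_eq_eval] using hx (f j) (Ideal.subset_span ⟨j, rfl⟩)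
  simp [this]

theorem jacPoly_isHomogeneous (hf : ∀ i, (f i).IsHomogeneous e) :
    (jacPoly n f).IsHomogeneous (n * (e - 1)) := by
  rw [jacPoly, Matrix.det_apply']
  refine IsHomogeneous.sum _ _ _ fun τ _ => ?_
  have hprod : (∏ i, Matrix.of (fun i j : Fin n => pderiv j (f i)) (τ i) i).IsHomogeneous
      (∑ _i : Fin n, (e - 1)) :=
    IsHomogeneous.prod _ _ _ fun i _ => (hf (τ i)).pderiv
  have hsign : ((Equiv.Perm.sign τ : ℤ) : MvPolynomial (Fin n) ℂ) =
      C ((Equiv.Perm.sign τ : ℤ) : ℂ) := by simp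
  rw [hsign]
  simpa using hprod.C_mul ((Equiv.Perm.sign τ : ℤ) : ℂ)

theorem jacobian_mulVec_X (hf : ∀ i, (f i).IsHomogeneous e) (i : Fin n) :
    (Matrix.of fun i j : Fin n => pderiv j (f i)).mulVec X i = e • f i := by
  rw [← (hf i).sum_X_mul_pderiv]
  simp [Matrix.mulVec, dotProduct, mul_comm]

theorem jacPoly_mul_X_mem (hf : ∀ i, (f i).IsHomogeneous e) (i : Fin n) :
    jacPoly n f * X i ∈ Ideal.span (Set.range f) :=
  det_mul_mem_of_mulVec_mem (fun j => by
    rw [jacobian_mulVec_X hf]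
    exact Submodule.smul_of_tower_mem _ e (Ideal.subset_span ⟨j, rfl⟩)) i

theorem exists_forall_X_pow_mem
    (hrad : ∀ i, (X i : MvPolynomial (Fin n) ℂ) ∈ (Ideal.span (Set.range f)).radical) :
    ∃ s, ∀ i, (X i : MvPolynomial (Fin n) ℂ) ^ (s + 1) ∈ Ideal.span (Set.range f) := by
  choose k hk using hrad
  refine ⟨∑ i, k i, fun i => Ideal.pow_mem_of_pow_mem _ (hk i) ?_⟩
  exact (Finset.single_le_sum (fun _ _ => Nat.zero_le _) (Finset.mem_univ i)).trans (Nat.le_succ _)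

theorem prod_X_pow_notMem_span_X_pow {K : Type*} [Field K] {ι : Type*} [Fintype ι] (s : ℕ) :
    ∏ i, (X i : MvPolynomial ι K) ^ s ∉
      Ideal.span (Set.range fun j => (X j : MvPolynomial ι K) ^ (s + 1)) := by
  classical
  rw [← Set.image_univ, mem_span_X_pow_image_iff]
  intro h
  have hprod : ∏ i, (X i : MvPolynomial ι K) ^ s =
      monomial (∑ i, Finsupp.single i s) 1 := by
    simp [X_pow_eq_monomial, monomial_sum_one]
  obtain ⟨j, -, hj⟩ := h (∑ i, Finsupp.single i s) (by rw [hprod]; simp)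
  simp [Finsupp.finsetSum_apply, Finsupp.single_apply] at hj

theorem jacPoly_notMem (he : e ≠ 0) (hf : ∀ i, (f i).IsHomogeneous e)
    (hrad : ∀ i, (X i : MvPolynomial (Fin n) ℂ) ∈ (Ideal.span (Set.range f)).radical) :
    jacPoly n f ∉ Ideal.span (Set.range f) := by
  intro hjac
  obtain ⟨s, hs⟩ := exists_forall_X_pow_mem hrad
  choose a ha using fun i => Ideal.mem_span_range_iff_exists_fun.1 (hs i)
  set J := Ideal.span (Set.range fun j => (X j : MvPolynomial (Fin n) ℂ) ^ (s + 1))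
  have haf : ∀ i, (Matrix.of a).mulVec f i = X i ^ (s + 1) := fun i => ha i
  have hmul : ∀ p ∈ Ideal.span (Set.range f), (Matrix.of a).det * p ∈ J := by
    intro p hp
    obtain ⟨c, rfl⟩ := Ideal.mem_span_range_iff_exists_fun.1 hp
    rw [Finset.mul_sum]
    refine J.sum_mem fun j _ => ?_
    rw [mul_left_comm]
    refine J.mul_mem_left _ (det_mul_mem_of_mulVec_mem (fun i => ?_) j)
    rw [haf]
    exact Ideal.subset_span ⟨i, rfl⟩
  have hdet := det_sub_prod_X_pow_mem (s := s)
    ((C (e : ℂ)⁻¹ : MvPolynomial (Fin n) ℂ) •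
      (Matrix.of a * Matrix.of fun i j : Fin n => pderiv j (f i))) fun i => by
    have hjv : (Matrix.of fun i j : Fin n => pderiv j (f i)).mulVec X = (e : ℕ) • f :=
      funext (jacobian_mulVec_X hf)
    have hce : (C (e : ℂ)⁻¹ : MvPolynomial (Fin n) ℂ) * (e : MvPolynomial (Fin n) ℂ) = 1 := by
      rw [← map_natCast (C : ℂ →+* MvPolynomial (Fin n) ℂ), ← C_mul,
        inv_mul_cancel₀ (by exact_mod_cast he), C_1]
    rw [Matrix.smul_mulVec, ← Matrix.mulVec_mulVec, hjv, Matrix.mulVec_smul, Pi.smul_apply,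
      Pi.smul_apply, haf, nsmul_eq_mul, smul_eq_mul, ← mul_assoc, hce, one_mul]
  rw [Matrix.det_smul, Matrix.det_mul] at hdet
  refine prod_X_pow_notMem_span_X_pow (K := ℂ) (ι := Fin n) s ?_
  have := J.sub_mem (J.mul_mem_left
    ((C (e : ℂ)⁻¹ : MvPolynomial (Fin n) ℂ) ^ Fintype.card (Fin n)) (hmul _ hjac)) hdet
  rwa [jacPoly, sub_sub_cancel] at this

end Jacobian

section Socle

variable {n e : ℕ} {f : Fin n → MvPolynomial (Fin n) ℂ}

theorem homogeneousComponent_mem_span_range (hf : ∀ i, (f i).IsHomogeneous e)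
    {p : MvPolynomial (Fin n) ℂ} (hp : p ∈ Ideal.span (Set.range f)) (k : ℕ) :
    homogeneousComponent k p ∈ Ideal.span (Set.range f) := by
  let _ := gradedAlgebra (σ := Fin n) (R := ℂ)
  refine homogeneousComponent_mem_of_mem (Ideal.homogeneous_span _ _ ?_) hp k
  rintro _ ⟨i, rfl⟩
  exact ⟨e, hf i⟩

theorem socle_degree_eq (he : e ≠ 0) (hf : ∀ i, (f i).IsHomogeneous e)
    (hrad : ∀ i, (X i : MvPolynomial (Fin n) ℂ) ∈ (Ideal.span (Set.range f)).radical)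
    {g : MvPolynomial (Fin n) ℂ} {k : ℕ} (hg : g.IsHomogeneous k)
    (hgI : g ∉ Ideal.span (Set.range f))
    (hsoc : ∀ i, X i * g ∈ Ideal.span (Set.range f)) : k = n * (e - 1) := by
  have hfm : ∀ i, f i ∈ idealOfVars (Fin n) ℂ := fun i => by
    rw [← pow_one (idealOfVars (Fin n) ℂ), mem_pow_idealOfVars_iff]
    intro x hx
    have hdeg : 1 ≤ e := Nat.one_le_iff_ne_zero.2 he
    rwa [(hf i).degree_eq_sum_deg_support hx] at hdeg
  have hann : ∀ p : MvPolynomial (Fin n) ℂ, (∀ i, X i * p ∈ Ideal.span (Set.range f)) →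
      ∀ a ∈ idealOfVars (Fin n) ℂ, a * p ∈ Ideal.span (Set.range f) := by
    intro p hp a ha
    rw [idealOfVars, Ideal.mem_span_range_iff_exists_fun] at ha
    obtain ⟨c, rfl⟩ := ha
    rw [Finset.sum_mul]
    exact Ideal.sum_mem _ fun i _ => by
      rw [mul_assoc]
      exact Ideal.mul_mem_left _ _ (hp i)
  obtain ⟨c, hc⟩ := socleDimLeOne_span_range hfm hrad (jacPoly n f) g
    (hann _ fun i => by rw [mul_comm]; exact jacPoly_mul_X_mem hf i) (hann _ hsoc) hgI
  by_contra hk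
  refine jacPoly_notMem he hf hrad ?_
  have := homogeneousComponent_mem_span_range hf hc (n * (e - 1))
  rwa [map_sub, map_smul, homogeneousComponent_of_mem hg, if_neg (Ne.symm hk), smul_zero, sub_zero,
    homogeneousComponent_eq_self (jacPoly_isHomogeneous hf)] at this

/-- A form outside the ideal has a monomial multiple of socle degree outside the ideal. -/
theorem exists_monomial_mul_notMem (he : e ≠ 0) (hf : ∀ i, (f i).IsHomogeneous e)
    (hrad : ∀ i, (X i : MvPolynomial (Fin n) ℂ) ∈ (Ideal.span (Set.range f)).radical)
    {g : MvPolynomial (Fin n) ℂ} {k : ℕ} (hg : g.IsHomogeneous k)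
    (hgI : g ∉ Ideal.span (Set.range f)) :
    ∃ b : Fin n →₀ ℕ, b.degree + k = n * (e - 1) ∧
      monomial b 1 * g ∉ Ideal.span (Set.range f) := by
  obtain ⟨T, hT⟩ : ∃ T, idealOfVars (Fin n) ℂ ^ T ≤ Ideal.span (Set.range f) := by
    refine Ideal.exists_pow_le_of_le_radical_of_fg (Ideal.span_le.2 ?_) (idealOfVars_fg _ _)
    rintro _ ⟨i, rfl⟩
    exact hrad i
  have hlt : ∀ {p : MvPolynomial (Fin n) ℂ} {j : ℕ}, p.IsHomogeneous j →
      p ∉ Ideal.span (Set.range f) → j < T := by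
    intro p j hp hpI
    by_contra! hj
    refine hpI (hT ((mem_pow_idealOfVars_iff _ _).2 fun x hx => ?_))
    rwa [hp.degree_eq_sum_deg_support hx] at hj
  induction hr : T - k generalizing g k with
  | zero => exact absurd (hlt hg hgI) (by omega)
  | succ r ih =>
    by_cases hsoc : ∀ i, X i * g ∈ Ideal.span (Set.range f)
    · exact ⟨0, by simpa using socle_degree_eq he hf hrad hg hgI hsoc, by simpa using hgI⟩
    · push Not at hsoc
      obtain ⟨i, hi⟩ := hsoc
      obtain ⟨b, hb, hbI⟩ := ih ((isHomogeneous_X ℂ i).mul hg) hi (by omega)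
      refine ⟨b + Finsupp.single i 1, ?_, ?_⟩
      · rw [map_add, Finsupp.degree_single]
        omega
      · rwa [monomial_add_single, pow_one, mul_assoc]

end Socle

section Apolarity

variable {n : ℕ}

theorem prod_factorial_add_single (b : Fin n →₀ ℕ) (i : Fin n) :
    ∏ j, ((b + Finsupp.single i 1 : Fin n →₀ ℕ) j).factorial =
      (b i + 1) * ∏ j, (b j).factorial := by
  rw [← Finset.mul_prod_erase _ _ (Finset.mem_univ i),
    ← Finset.mul_prod_erase _ (fun j => (b j).factorial) (Finset.mem_univ i), ← mul_assoc]
  congr 1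
  · simp [Nat.factorial_succ]
  · refine Finset.prod_congr rfl fun j hj => ?_
    simp [(Finset.ne_of_mem_erase hj).symm]

theorem coeff_pdEnd_pow_mul_factorial (i : Fin n) (k : ℕ) (b : Fin n →₀ ℕ)
    (F : MvPolynomial (Fin n) ℂ) :
    coeff b ((pdEnd n i ^ k) F) * ∏ j, ((b j).factorial : ℂ) =
      coeff (b + Finsupp.single i k) F *
        ∏ j, (((b + Finsupp.single i k : Fin n →₀ ℕ) j).factorial : ℂ) := by
  induction k generalizing b with
  | zero => simp
  | succ k ih =>
    have hfac := congrArg (Nat.cast (R := ℂ)) (prod_factorial_add_single b i)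
    rw [Nat.cast_mul, Nat.cast_prod, Nat.cast_prod, Nat.cast_add, Nat.cast_one] at hfac
    have hsingle : b + Finsupp.single i (k + 1) =
        b + Finsupp.single i 1 + Finsupp.single i k := by
      rw [add_comm k 1, Finsupp.single_add, add_assoc]
    rw [hsingle, ← ih, pow_succ', Module.End.mul_apply, hfac, ← mul_assoc]
    congr 1
    exact coeff_pderiv _ _

theorem coeff_list_prod_pdEnd_mul_factorial (l : List (Fin n)) (a b : Fin n →₀ ℕ)
    (F : MvPolynomial (Fin n) ℂ) :
    coeff b ((l.map fun i => pdEnd n i ^ a i).prod F) * ∏ j, ((b j).factorial : ℂ) =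
      coeff (b + (l.map fun i => Finsupp.single i (a i)).sum) F *
        ∏ j, (((b + (l.map fun i => Finsupp.single i (a i)).sum) j).factorial : ℂ) := by
  induction l generalizing b with
  | nil => simp
  | cons i l ih =>
    rw [List.map_cons, List.prod_cons, Module.End.mul_apply, coeff_pdEnd_pow_mul_factorial, ih,
      List.map_cons, List.sum_cons, add_assoc]

theorem coeff_diamond_mul_factorial (g F : MvPolynomial (Fin n) ℂ) (b : Fin n →₀ ℕ) :
    coeff b (diamond g F) * ∏ j, ((b j).factorial : ℂ) =
      ∑ a ∈ g.support, coeff a g * (coeff (b + a) F * ∏ j, (((b + a) j).factorial : ℂ)) := by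
  rw [diamond, coeff_sum, Finset.sum_mul]
  refine Finset.sum_congr rfl fun a _ => ?_
  have hsum : ((List.finRange n).map fun i => Finsupp.single i (a i)).sum = a := by
    rw [← List.ofFn_eq_map, List.sum_ofFn, Finsupp.univ_sum_single]
  rw [coeff_smul, smul_eq_mul, mul_assoc, List.ofFn_eq_map, coeff_list_prod_pdEnd_mul_factorial,
    hsum]

/-- The functional on polynomials given by the coefficients `μ` in degree `N` and zero in the other
degrees. -/
noncomputable def assocFunctional (N : ℕ) (μ : (Fin n → ℕ) → ℂ) :
    MvPolynomial (Fin n) ℂ →ₗ[ℂ] ℂ :=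
  (basisMonomials (Fin n) ℂ).constr ℂ fun c => if c.degree = N then μ c else 0

theorem assocFunctional_monomial (N : ℕ) (μ : (Fin n → ℕ) → ℂ) (c : Fin n →₀ ℕ) (r : ℂ) :
    assocFunctional N μ (monomial c r) = r * if c.degree = N then μ c else 0 := by
  have h := (basisMonomials (Fin n) ℂ).constr_basis ℂ
    (fun c => if c.degree = N then μ c else 0) c
  rw [coe_basisMonomials] at h
  rw [← mul_one r, ← smul_eq_mul, ← smul_monomial, map_smul, assocFunctional, h]
  simp

theorem coeff_assocForm_mul_factorial (d : ℕ) (μ : (Fin n → ℕ) → ℂ) (c : Fin n →₀ ℕ) :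
    coeff c (assocForm n d μ) * ∏ j, ((c j).factorial : ℂ) =
      (n * (d - 2)).factorial * if c.degree = n * (d - 2) then μ c else 0 := by
  have hcoeff : ∀ m : Fin n → ℕ, coeff c (∏ i, (X i : MvPolynomial (Fin n) ℂ) ^ m i) =
      if m = c then 1 else 0 := by
    intro m
    have hm : ∏ i, (X i : MvPolynomial (Fin n) ℂ) ^ m i =
        monomial (Finsupp.equivFunOnFinite.symm m) 1 := by
      rw [monomial_eq, Finsupp.prod_fintype _ _ (by simp)]
      simp
    rw [hm, coeff_monomial]
    simp only [Equiv.symm_apply_eq]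
    rfl
  simp only [assocForm, coeff_sum, coeff_C_mul, hcoeff, mul_ite, mul_one, mul_zero,
    Finset.sum_ite_eq', Finset.Nat.mem_antidiagonalTuple, ← Finsupp.degree_eq_sum]
  split_ifs with h
  · have hspec := congrArg (Nat.cast (R := ℂ)) (Nat.multinomial_spec Finset.univ (c : Fin n → ℕ))
    rw [← Finsupp.degree_eq_sum, h] at hspec
    push_cast at hspec
    rw [← hspec]
    ring
  · simp

theorem coeff_diamond_assocForm_mul_factorial (d : ℕ) (μ : (Fin n → ℕ) → ℂ)
    (g : MvPolynomial (Fin n) ℂ) (b : Fin n →₀ ℕ) :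
    coeff b (diamond g (assocForm n d μ)) * ∏ j, ((b j).factorial : ℂ) =
      (n * (d - 2)).factorial * assocFunctional (n * (d - 2)) μ (monomial b 1 * g) := by
  conv_rhs => rw [g.as_sum]
  simp only [coeff_diamond_mul_factorial, coeff_assocForm_mul_factorial, Finset.mul_sum, map_sum,
    monomial_mul, assocFunctional_monomial, one_mul]
  exact Finset.sum_congr rfl fun a _ => by ring

theorem diamond_assocForm_eq_zero_iff (d : ℕ) (μ : (Fin n → ℕ) → ℂ)
    (g : MvPolynomial (Fin n) ℂ) :
    diamond g (assocForm n d μ) = 0 ↔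
      ∀ b, assocFunctional (n * (d - 2)) μ (monomial b 1 * g) = 0 := by
  rw [MvPolynomial.ext_iff]
  refine forall_congr' fun b => ?_
  have h := coeff_diamond_assocForm_mul_factorial d μ g b
  have hb : ∏ j, ((b j).factorial : ℂ) ≠ 0 :=
    Finset.prod_ne_zero_iff.2 fun j _ => by exact_mod_cast (b j).factorial_ne_zero
  have hN : ((n * (d - 2)).factorial : ℂ) ≠ 0 := by exact_mod_cast Nat.factorial_ne_zero _
  rw [coeff_zero]
  constructor
  · intro h0
    simpa [h0, hN] using h.symm
  · intro h0
    simpa [h0, hb] using h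

theorem homogeneousComponent_sub_assocFunctional_mem {d : ℕ}
    {f : Fin n → MvPolynomial (Fin n) ℂ} {μ : (Fin n → ℕ) → ℂ} (hμ : IsAssocCoeffsT n d f μ)
    (p : MvPolynomial (Fin n) ℂ) :
    homogeneousComponent (n * (d - 2)) p - C (assocFunctional (n * (d - 2)) μ p) * jacPoly n f ∈
      Ideal.span (Set.range f) := by
  induction p using MvPolynomial.induction_on' with
  | monomial c r =>
    rw [homogeneousComponent_of_mem (isHomogeneous_monomial r rfl), assocFunctional_monomial]
    by_cases hc : c.degree = n * (d - 2)
    · have h := Ideal.mul_mem_left _ (C r) (hμ c (by rw [← hc, Finsupp.degree_eq_sum]))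
      rw [if_pos hc.symm, if_pos hc, C_mul, mul_assoc]
      rw [mul_sub] at h
      rwa [monomial_eq, Finsupp.prod_fintype _ _ (by simp)]
    · simp [hc, Ne.symm hc]
  | add p q hp hq =>
    have h := Ideal.add_mem _ hp hq
    convert h using 1
    simp only [map_add]
    ring

/-- The functional detects membership of the component of top degree in the ideal. -/
theorem assocFunctional_eq_zero_iff {d : ℕ} {f : Fin n → MvPolynomial (Fin n) ℂ}
    {μ : (Fin n → ℕ) → ℂ} (hμ : IsAssocCoeffsT n d f μ)
    (hjac : jacPoly n f ∉ Ideal.span (Set.range f)) (p : MvPolynomial (Fin n) ℂ) :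
    assocFunctional (n * (d - 2)) μ p = 0 ↔
      homogeneousComponent (n * (d - 2)) p ∈ Ideal.span (Set.range f) := by
  have h := homogeneousComponent_sub_assocFunctional_mem hμ p
  constructor
  · intro h0
    simpa [h0] using h
  · intro hp
    by_contra hne
    refine hjac ?_
    have h1 := Ideal.mul_mem_left _ (C (assocFunctional (n * (d - 2)) μ p)⁻¹)
      (Ideal.sub_mem _ hp h)
    rwa [sub_sub_cancel, ← mul_assoc, ← C_mul, inv_mul_cancel₀ hne, C_1, one_mul] at h1

end Apolarity

/-- The associated form `𝐟` of an `n`-tuple `𝔣` of degree `d-1` forms whose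
only common zero is the origin is a Macaulay inverse system of `M_𝔣`: its apolar ideal
`𝐟^⊥ = {g : g ⋄ 𝐟 = 0}` equals the ideal `(f_1,…,f_n)`. -/
theorem apolar_of_assocForm_eq_span
    (n d : ℕ) (hn : 2 ≤ n) (hd : 3 ≤ d)
    (f : Fin n → MvPolynomial (Fin n) ℂ)
    (hf : ∀ i, (f i).IsHomogeneous (d - 1))
    (hzero : ∀ p : Fin n → ℂ, (∀ i, eval p (f i) = 0) → p = 0)
    (μ : (Fin n → ℕ) → ℂ) (hμ : IsAssocCoeffsT n d f μ) :
    {g : MvPolynomial (Fin n) ℂ | diamond g (assocForm n d μ) = 0}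
      = (Ideal.span (Set.range f) : Set (MvPolynomial (Fin n) ℂ)) := by
  have he : d - 1 ≠ 0 := by omega
  have hrad := X_mem_radical_span_range hzero
  have hdeg : n * (d - 1 - 1) = n * (d - 2) := by rw [Nat.sub_sub]
  ext g
  rw [Set.mem_ofPred_eq, diamond_assocForm_eq_zero_iff, SetLike.mem_coe]
  simp only [assocFunctional_eq_zero_iff hμ (jacPoly_notMem he hf hrad)]
  constructor
  · intro h
    rw [← sum_homogeneousComponent g]
    refine Ideal.sum_mem _ fun k _ => ?_
    by_contra hk
    obtain ⟨b, hb, hbI⟩ := exists_monomial_mul_notMem he hf hrad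
      (homogeneousComponent_isHomogeneous k g) hk
    rw [hdeg] at hb
    refine hbI ?_
    have hcomp : homogeneousComponent (n * (d - 2)) (monomial b 1 * g) =
        monomial b 1 * homogeneousComponent k g := by
      rw [← hb]
      ext c
      rw [coeff_homogeneousComponent, coeff_monomial_mul', coeff_monomial_mul',
        coeff_homogeneousComponent]
      by_cases hbc : b ≤ c
      · obtain ⟨a, rfl⟩ := exists_add_of_le hbc
        simp
      · simp [hbc]
    exact hcomp ▸ h b
  · intro hg b
    exact homogeneousComponent_mem_span_range hf (Ideal.mul_mem_left _ _ hg) _
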